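/- Let G be a connected graph of order n ≥ 4 with m edges. Then HSO(G) ≥ 2(√5 − √2)n + (3√2 − 2√5)m, with equality if and only if G is the path P_n or the cycle C_n. -/

import Mathlib

open SimpleGraph Finset Real

noncomputable def HSO {V : Type*} [Fintype V] (G : SimpleGraph V) : ℝ :=
  letI := Classical.decRel G.Adj
  ∑ e ∈ G.edgeFinset, Sym2.lift
    ⟨fun x y => Real.sqrt ((G.degree x : ℝ) ^ 2 + (G.degree y : ℝ) ^ 2) /
      min (G.degree x : ℝ) (G.degree y : ℝ),
     fun x y => by simp [add_comm, min_comm]⟩ e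

noncomputable def SO {V : Type*} [Fintype V] (G : SimpleGraph V) : ℝ :=
  letI := Classical.decRel G.Adj
  ∑ e ∈ G.edgeFinset, Sym2.lift
    ⟨fun x y => Real.sqrt ((G.degree x : ℝ) ^ 2 + (G.degree y : ℝ) ^ 2),
     fun x y => by simp [add_comm]⟩ e

noncomputable def cDSO {V : Type*} [Fintype V] (G : SimpleGraph V) : ℝ :=
  letI := Classical.decRel G.Adj
  ∑ e ∈ G.edgeFinset, Sym2.lift
    ⟨fun x y => Real.sqrt ((G.degree x : ℝ) ^ 2 + (G.degree y : ℝ) ^ 2) /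
      max (G.degree x : ℝ) (G.degree y : ℝ),
     fun x y => by simp [add_comm, max_comm]⟩ e

noncomputable def M1 {V : Type*} [Fintype V] (G : SimpleGraph V) : ℝ :=
  letI := Classical.decRel G.Adj
  ∑ e ∈ G.edgeFinset, Sym2.lift
    ⟨fun x y => (G.degree x : ℝ) + (G.degree y : ℝ),
     fun x y => by simp [add_comm]⟩ e

def IsRegularGraph {V : Type*} [Fintype V] (G : SimpleGraph V) : Prop :=
  letI := Classical.decRel G.Adj
  ∃ k, G.IsRegularOfDegree k

def addEdge {V : Type*} (G : SimpleGraph V) (u v : V) : SimpleGraph V :=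
  G ⊔ SimpleGraph.fromEdgeSet {s(u, v)}

namespace SimpleGraph

variable {V : Type*} {G : SimpleGraph V}

/-- A nonempty set of vertices closed under adjacency in a connected graph is everything. -/
lemma Preconnected.mem_of_forall_adj (hG : G.Preconnected) {S : Set V}
    (hS : ∀ x ∈ S, ∀ y, G.Adj x y → y ∈ S) {x : V} (hx : x ∈ S) (y : V) : y ∈ S := by
  obtain ⟨p⟩ := hG x y
  induction p with
  | nil => exact hx
  | cons h _ ih => exact ih (hS _ hx _ h)

/-- Among three neighbours of a vertex of degree at most two, two coincide. -/
lemma eq_or_eq_or_eq_of_degree_le_two {v a b c : V} [Fintype (G.neighborSet v)]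
    (hv : G.degree v ≤ 2) (ha : G.Adj v a) (hb : G.Adj v b) (hc : G.Adj v c) :
    a = b ∨ a = c ∨ b = c := by
  classical
  by_contra! h
  have hsub : ({a, b, c} : Finset V) ⊆ G.neighborFinset v := by
    intro x hx
    simp only [Finset.mem_insert, Finset.mem_singleton] at hx
    rcases hx with rfl | rfl | rfl <;> simpa
  have := Finset.card_le_card hsub
  rw [Finset.card_eq_three.2 ⟨a, b, c, h.1, h.2.1, h.2.2, rfl⟩, card_neighborFinset_eq_degree] at this
  omega

/-- The vertices `f 0, …, f k` are distinct and consecutive ones are adjacent. -/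
def IsPathMap (G : SimpleGraph V) (f : ℕ → V) (k : ℕ) : Prop :=
  Set.InjOn f (Set.Iic k) ∧ ∀ i < k, G.Adj (f i) (f (i + 1))

namespace IsPathMap

variable {f : ℕ → V} {k : ℕ}

lemma lt_card [Fintype V] (hf : G.IsPathMap f k) : k < Fintype.card V := by
  have hinj : Function.Injective fun i : Fin (k + 1) ↦ f i := fun i j h ↦
    Fin.ext (hf.1 (Nat.lt_succ_iff.1 i.2) (Nat.lt_succ_iff.1 j.2) h)
  simpa using Fintype.card_le_of_injective _ hinj

lemma reverse (hf : G.IsPathMap f k) : G.IsPathMap (fun i ↦ f (k - i)) k := by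
  refine ⟨fun i hi j hj h ↦ ?_, fun i hi ↦ ?_⟩
  · have := hf.1 (Set.mem_Iic.2 (Nat.sub_le k i)) (Set.mem_Iic.2 (Nat.sub_le k j)) h
    simp only [Set.mem_Iic] at hi hj
    omega
  · have := hf.2 (k - (i + 1)) (by omega)
    rw [show k - (i + 1) + 1 = k - i by omega] at this
    exact this.symm

lemma snoc (hf : G.IsPathMap f k) {w : V} (hw : G.Adj (f k) w) (hw' : w ∉ f '' Set.Iic k) :
    G.IsPathMap (fun i ↦ if i ≤ k then f i else w) (k + 1) := by
  have hne : ∀ i ≤ k, f i ≠ w := fun i hi h ↦ hw' ⟨i, hi, h⟩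
  refine ⟨fun i hi j hj h ↦ ?_, fun i hi ↦ ?_⟩
  · simp only [Set.mem_Iic] at hi hj
    dsimp only at h
    split_ifs at h with h₁ h₂ h₂
    · exact hf.1 h₁ h₂ h
    · exact absurd h (hne i h₁)
    · exact absurd h.symm (hne j h₂)
    · omega
  · dsimp only
    rcases (Nat.lt_succ_iff.1 hi).lt_or_eq with h | rfl
    · rw [if_pos h.le, if_pos (Nat.succ_le_of_lt h)]
      exact hf.2 i h
    · simpa using hw

end IsPathMap

/-- A finite connected graph with maximum degree at most two has a Hamiltonian path. -/
lemma Connected.exists_isPathMap [Fintype V] [DecidableRel G.Adj] (hG : G.Connected)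
    (hdeg : ∀ v, G.degree v ≤ 2) :
    ∃ f k, G.IsPathMap f k ∧ ∀ v, v ∈ f '' Set.Iic k := by
  classical
  obtain ⟨v₀⟩ := hG.nonempty
  have h₀ : ∃ f, G.IsPathMap f 0 := ⟨fun _ ↦ v₀, by
    refine ⟨fun i hi j hj _ ↦ ?_, fun i hi ↦ absurd hi i.not_lt_zero⟩
    simp only [Set.mem_Iic] at hi hj
    omega⟩
  set k := Nat.findGreatest (fun k ↦ ∃ f, G.IsPathMap f k) (Fintype.card V) with hk
  obtain ⟨f, hf⟩ : ∃ f, G.IsPathMap f k :=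
    Nat.findGreatest_spec (P := fun k ↦ ∃ f, G.IsPathMap f k) (Nat.zero_le _) h₀
  have hmax : ∀ g, ¬ G.IsPathMap g (k + 1) := fun g hg ↦ by
    have := Nat.le_findGreatest (P := fun k ↦ ∃ f, G.IsPathMap f k) hg.lt_card.le ⟨g, hg⟩
    omega
  refine ⟨f, k, hf, hG.preconnected.mem_of_forall_adj ?_ ⟨0, Nat.zero_le k, rfl⟩⟩
  rintro _ ⟨i, hi, rfl⟩ w hw
  rw [Set.mem_Iic] at hi
  by_contra hw'
  rcases hi.lt_or_eq with hik | rfl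
  · rcases Nat.eq_zero_or_pos i with rfl | hi0
    · refine hmax _ (hf.reverse.snoc (w := w) (by simpa using hw) ?_)
      rintro ⟨j, -, rfl⟩
      exact hw' ⟨k - j, Nat.sub_le k j, rfl⟩
    · have hprev := hf.2 (i - 1) (by omega)
      rw [Nat.sub_add_cancel hi0] at hprev
      rcases eq_or_eq_or_eq_of_degree_le_two (hdeg (f i)) hprev.symm (hf.2 i hik) hw with h | h | h
      · have := hf.1 (Set.mem_Iic.2 (by omega)) (Set.mem_Iic.2 (by omega)) h
        omega
      · exact hw' ⟨i - 1, Set.mem_Iic.2 (by omega), h⟩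
      · exact hw' ⟨i + 1, hik, h⟩
  · exact hmax _ (hf.snoc hw hw')

/-- In a path map whose vertices have degree at most two, only the endpoints can be adjacent
besides consecutive vertices. -/
lemma IsPathMap.eq_of_adj {f : ℕ → V} {k : ℕ} [Fintype V] [DecidableRel G.Adj]
    (hf : G.IsPathMap f k) (hdeg : ∀ v, G.degree v ≤ 2) {i j : ℕ} (hij : i < j) (hj : j ≤ k)
    (h : G.Adj (f i) (f j)) : j = i + 1 ∨ i = 0 ∧ j = k := by
  have inj : ∀ {a b}, a ≤ k → b ≤ k → f a = f b → a = b := fun ha hb h ↦ hf.1 ha hb h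
  by_contra! hne
  rcases Nat.eq_zero_or_pos i with rfl | hi0
  · have hjk : j < k := lt_of_le_of_ne hj (hne.2 rfl)
    have hprev := hf.2 (j - 1) (by omega)
    rw [Nat.sub_add_cancel hij] at hprev
    rcases eq_or_eq_or_eq_of_degree_le_two (hdeg (f j)) hprev.symm (hf.2 j hjk) h.symm with
      h | h | h
    · have := inj (by omega) (by omega) h; omega
    · have := inj (by omega) (by omega) h; omega
    · have := inj (by omega) (by omega) h; omega
  · have hprev := hf.2 (i - 1) (by omega)
    rw [Nat.sub_add_cancel hi0] at hprev
    rcases eq_or_eq_or_eq_of_degree_le_two (hdeg (f i)) hprev.symm (hf.2 i (by omega)) h with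
      h | h | h
    · have := inj (by omega) (by omega) h; omega
    · have := inj (by omega) (by omega) h; omega
    · have := inj (by omega) (by omega) h; omega

lemma cycleGraph_adj_iff_val {n : ℕ} {i j : Fin (n + 1)} (h : i.val < j.val) :
    (cycleGraph (n + 1)).Adj i j ↔ j.val = i.val + 1 ∨ i.val = 0 ∧ j.val = n := by
  have hi := i.2
  have hj := j.2
  rw [cycleGraph_adj', Fin.sub_val_of_le (Fin.le_def.2 h.le), Fin.coe_sub_iff_lt.2 (Fin.lt_def.2 h)]
  omega

/-- A finite connected graph with maximum degree at most two is a path or a cycle. -/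
lemma Connected.nonempty_iso_pathGraph_or_cycleGraph [Fintype V] [DecidableRel G.Adj]
    (hG : G.Connected) (hdeg : ∀ v, G.degree v ≤ 2) :
    Nonempty (G ≃g pathGraph (Fintype.card V)) ∨ Nonempty (G ≃g cycleGraph (Fintype.card V)) := by
  obtain ⟨f, k, hf, hsurj⟩ := hG.exists_isPathMap hdeg
  have hbij : Function.Bijective fun i : Fin (k + 1) ↦ f i := by
    refine ⟨fun i j h ↦ Fin.ext (hf.1 (Nat.lt_succ_iff.1 i.2) (Nat.lt_succ_iff.1 j.2) h),
      fun v ↦ ?_⟩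
    obtain ⟨i, hi, rfl⟩ := hsurj v
    exact ⟨⟨i, Nat.lt_succ_iff.2 hi⟩, rfl⟩
  have hcard : Fintype.card V = k + 1 := by simpa using (Fintype.card_of_bijective hbij).symm
  rw [hcard]
  let e := Equiv.ofBijective _ hbij
  have isoOfLt : ∀ H : SimpleGraph (Fin (k + 1)),
      (∀ i j : Fin (k + 1), i.val < j.val → (G.Adj (f i) (f j) ↔ H.Adj i j)) → Nonempty (G ≃g H) := by
    intro H hH
    refine ⟨Iso.symm ⟨e, ?_⟩⟩
    intro i j
    change G.Adj (f i) (f j) ↔ H.Adj i j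
    rcases lt_trichotomy i.val j.val with h | h | h
    · exact hH i j h
    · rw [Fin.ext h]; simp
    · rw [G.adj_comm, H.adj_comm]; exact hH j i h
  by_cases hc : G.Adj (f 0) (f k)
  · refine Or.inr (isoOfLt _ fun i j hij ↦ ?_)
    rw [cycleGraph_adj_iff_val hij]
    refine ⟨hf.eq_of_adj hdeg hij (Nat.lt_succ_iff.1 j.2), ?_⟩
    rintro (h | ⟨h, h'⟩)
    · rw [h]; exact hf.2 _ (by omega)
    · rwa [h, h']
  · refine Or.inl (isoOfLt _ fun i j hij ↦ ?_)
    rw [pathGraph_adj]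
    refine ⟨fun h ↦ ?_, ?_⟩
    · rcases hf.eq_of_adj hdeg hij (Nat.lt_succ_iff.1 j.2) h with h' | ⟨h₀, h₁⟩
      · exact Or.inl h'.symm
      · rw [h₀, h₁] at h
        exact absurd h hc
    · rintro (h | h)
      · rw [← h]; exact hf.2 _ (by omega)
      · omega

lemma cycleGraph_degree_le_two {n : ℕ} (v : Fin n) : (cycleGraph n).degree v ≤ 2 := by
  match n, v with
  | 1, v => simp [cycleGraph_one_eq_bot]
  | n + 2, v => rw [cycleGraph_degree_two_le]; exact Finset.card_le_two

lemma pathGraph_degree_le_two {n : ℕ} (v : Fin n) [Fintype ((pathGraph n).neighborSet v)] :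
    (pathGraph n).degree v ≤ 2 :=
  (degree_le_of_le pathGraph_le_cycleGraph).trans (cycleGraph_degree_le_two v)

/-- In a finite connected graph on at least three vertices no edge joins two leaves. -/
lemma Connected.degree_ne_one_or_of_adj [Fintype V] [DecidableRel G.Adj] (hG : G.Connected)
    (hV : 3 ≤ Fintype.card V) {x y : V} (h : G.Adj x y) : ¬ (G.degree x = 1 ∧ G.degree y = 1) := by
  classical
  rintro ⟨hx, hy⟩
  have key : ∀ {u v w : V}, G.degree u = 1 → G.Adj u v → G.Adj u w → w = v := by
    intro u v w hu hv hw
    obtain ⟨z, -, hz⟩ := degree_eq_one_iff_existsUnique_adj.1 hu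
    rw [hz _ hv, hz _ hw]
  have hall := hG.preconnected.mem_of_forall_adj (S := {x, y}) (x := x) (by
    rintro u (rfl | rfl) w hw
    · exact Or.inr (key hx h hw)
    · exact Or.inl (key hy h.symm hw)) (Or.inl rfl)
  have : Fintype.card V ≤ ({x, y} : Finset V).card :=
    Finset.card_le_card fun v _ ↦ by simpa using hall v
  have := Finset.card_le_two (a := x) (b := y)
  omega

/-- Summing `g x + g y` over the edges `xy` counts `g v` once for each edge at `v`. -/
lemma sum_edgeFinset_lift_add [Fintype V] [DecidableRel G.Adj] (g : V → ℝ) :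
    ∑ e ∈ G.edgeFinset, Sym2.lift ⟨fun x y ↦ g x + g y, fun _ _ ↦ add_comm _ _⟩ e =
      ∑ v, G.degree v * g v := by
  classical
  have h₁ : ∀ e ∈ G.edgeFinset,
      Sym2.lift ⟨fun x y ↦ g x + g y, fun _ _ ↦ add_comm _ _⟩ e =
        ∑ v, if v ∈ e then g v else 0 := by
    intro e he
    induction e with
    | _ x y =>
      have hne : x ≠ y := (mem_edgeFinset.1 he : G.Adj x y).ne
      rw [← Finset.sum_filter, show ({v | v ∈ s(x, y)} : Finset V) = {x, y} by ext; simp,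
        Finset.sum_pair hne]
      rfl
  rw [Finset.sum_congr rfl h₁, Finset.sum_comm]
  refine Finset.sum_congr rfl fun v _ ↦ ?_
  rw [← Finset.sum_filter, ← incidenceFinset_eq_filter, Finset.sum_const,
    card_incidenceFinset_eq_degree, nsmul_eq_mul]

end SimpleGraph

lemma edgeWeight_lower_bound_of_le {a b : ℕ} (ha : 1 ≤ a) (hab : a ≤ b) (h1 : b ≠ 1) :
    2 * (√5 - √2) * ((a : ℝ)⁻¹ + (b : ℝ)⁻¹) + (3 * √2 - 2 * √5) ≤ √((a : ℝ) ^ 2 + (b : ℝ) ^ 2) / a ∧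
    (√((a : ℝ) ^ 2 + (b : ℝ) ^ 2) / a =
      2 * (√5 - √2) * ((a : ℝ)⁻¹ + (b : ℝ)⁻¹) + (3 * √2 - 2 * √5) ↔ b ≤ 2) := by
  have hc : 0 < √5 - √2 := sub_pos.2 (Real.sqrt_lt_sqrt (by norm_num) (by norm_num))
  have hb2 : 2 ≤ b := by omega
  rcases hb2.eq_or_lt with rfl | hb3
  · obtain rfl | rfl : a = 1 ∨ a = 2 := by omega
    · have : √(((1 : ℕ) : ℝ) ^ 2 + ((2 : ℕ) : ℝ) ^ 2) / (1 : ℕ) =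
          2 * (√5 - √2) * (((1 : ℕ) : ℝ)⁻¹ + ((2 : ℕ) : ℝ)⁻¹) + (3 * √2 - 2 * √5) := by
        norm_num
        ring
      exact ⟨this.ge, by simpa using this⟩
    · have : √(((2 : ℕ) : ℝ) ^ 2 + ((2 : ℕ) : ℝ) ^ 2) / (2 : ℕ) =
          2 * (√5 - √2) * (((2 : ℕ) : ℝ)⁻¹ + ((2 : ℕ) : ℝ)⁻¹) + (3 * √2 - 2 * √5) := by
        rw [show ((2 : ℕ) : ℝ) ^ 2 + ((2 : ℕ) : ℝ) ^ 2 = 2 ^ 2 * 2 by norm_num,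
          Real.sqrt_mul (by norm_num), Real.sqrt_sq (by norm_num)]
        push_cast
        ring
      exact ⟨this.ge, by simpa using this⟩
  · have hb3' : (3 : ℝ) ≤ b := by exact_mod_cast hb3
    have hbinv : (b : ℝ)⁻¹ < 2⁻¹ := inv_strictAnti₀ (by norm_num) (by linarith)
    have hlt : 2 * (√5 - √2) * ((a : ℝ)⁻¹ + (b : ℝ)⁻¹) + (3 * √2 - 2 * √5) <
        √((a : ℝ) ^ 2 + (b : ℝ) ^ 2) / a := by
      rcases ha.eq_or_lt with rfl | ha2
      · have hsqrt : √5 ≤ √(((1 : ℕ) : ℝ) ^ 2 + (b : ℝ) ^ 2) :=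
          Real.sqrt_le_sqrt (by push_cast; nlinarith)
        have := mul_lt_mul_of_pos_left hbinv hc
        rw [Nat.cast_one, inv_one, div_one]
        rw [Nat.cast_one] at hsqrt
        refine lt_of_lt_of_le ?_ hsqrt
        linarith
      · have ha2' : (2 : ℝ) ≤ a := by exact_mod_cast ha2
        have hab' : (a : ℝ) ≤ b := by exact_mod_cast hab
        have hainv : (a : ℝ)⁻¹ ≤ 2⁻¹ := inv_anti₀ (by norm_num) ha2'
        have : √2 ≤ √((a : ℝ) ^ 2 + (b : ℝ) ^ 2) / a := by
          rw [le_div_iff₀ (by linarith), Real.le_sqrt (by positivity) (by positivity), mul_pow,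
            Real.sq_sqrt (by norm_num)]
          nlinarith
        have := mul_lt_mul_of_pos_left (add_lt_add_of_le_of_lt hainv hbinv) hc
        linarith
    exact ⟨hlt.le, iff_of_false hlt.ne' (by omega)⟩

/-- The contribution of an edge with end degrees `a` and `b` to the hyperbolic Sombor index. -/
lemma edgeWeight_lower_bound {a b : ℕ} (ha : 1 ≤ a) (hb : 1 ≤ b) (h1 : ¬ (a = 1 ∧ b = 1)) :
    2 * (√5 - √2) * ((a : ℝ)⁻¹ + (b : ℝ)⁻¹) + (3 * √2 - 2 * √5) ≤
      √((a : ℝ) ^ 2 + (b : ℝ) ^ 2) / min (a : ℝ) (b : ℝ) ∧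
    (2 * (√5 - √2) * ((a : ℝ)⁻¹ + (b : ℝ)⁻¹) + (3 * √2 - 2 * √5) =
      √((a : ℝ) ^ 2 + (b : ℝ) ^ 2) / min (a : ℝ) (b : ℝ) ↔ a ≤ 2 ∧ b ≤ 2) := by
  rw [eq_comm]
  rcases le_total a b with hab | hab
  · rw [min_eq_left (Nat.cast_le.2 hab)]
    obtain ⟨h, h'⟩ := edgeWeight_lower_bound_of_le ha hab (by omega)
    exact ⟨h, h'.trans (by omega)⟩
  · rw [min_eq_right (Nat.cast_le.2 hab), add_comm ((a : ℝ) ^ 2), add_comm (a : ℝ)⁻¹]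
    obtain ⟨h, h'⟩ := edgeWeight_lower_bound_of_le hb hab (by omega)
    exact ⟨h, h'.trans (by omega)⟩

theorem stmt7 {V : Type*} [Fintype V] (G : SimpleGraph V) [DecidableRel G.Adj]
    (n m : ℕ) (hn : n = Fintype.card V) (hm : m = G.edgeFinset.card)
    (hn4 : 4 ≤ n) (hconn : G.Connected) :
    2 * (Real.sqrt 5 - Real.sqrt 2) * n + (3 * Real.sqrt 2 - 2 * Real.sqrt 5) * m ≤ HSO G ∧
    (HSO G = 2 * (Real.sqrt 5 - Real.sqrt 2) * n + (3 * Real.sqrt 2 - 2 * Real.sqrt 5) * m ↔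
      Nonempty (G ≃g pathGraph n) ∨ Nonempty (G ≃g cycleGraph n)) := by
  obtain rfl : ‹DecidableRel G.Adj› = Classical.decRel G.Adj := Subsingleton.elim _ _
  let := Classical.decRel G.Adj
  subst hn hm
  have : Nontrivial V := Fintype.one_lt_card_iff_nontrivial.1 (by omega)
  have hpos : ∀ v, 1 ≤ G.degree v := fun v ↦ hconn.preconnected.degree_pos_of_nontrivial v
  set g : V → ℝ := fun v ↦ (G.degree v : ℝ)⁻¹ with hg
  set r : Sym2 V → ℝ := fun e ↦
    2 * (√5 - √2) * Sym2.lift ⟨fun x y ↦ g x + g y, fun _ _ ↦ add_comm _ _⟩ e +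
      (3 * √2 - 2 * √5) with hr
  have hsum : 2 * (√5 - √2) * (Fintype.card V : ℝ) + (3 * √2 - 2 * √5) * (G.edgeFinset.card : ℝ) =
      ∑ e ∈ G.edgeFinset, r e := by
    rw [hr, Finset.sum_add_distrib, ← Finset.mul_sum, sum_edgeFinset_lift_add, Finset.sum_const,
      nsmul_eq_mul, mul_comm (3 * √2 - 2 * √5)]
    congr 2
    rw [Finset.sum_congr rfl fun v _ ↦
      mul_inv_cancel₀ (Nat.cast_ne_zero.2 (Nat.one_le_iff_ne_zero.1 (hpos v)))]
    simp
  have hedge : ∀ x y, G.Adj x y → _ := fun x y hxy ↦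
    edgeWeight_lower_bound (hpos x) (hpos y) (hconn.degree_ne_one_or_of_adj (by omega) hxy)
  have hle : ∀ e ∈ G.edgeFinset, r e ≤ Sym2.lift
      ⟨fun x y => Real.sqrt ((G.degree x : ℝ) ^ 2 + (G.degree y : ℝ) ^ 2) /
        min (G.degree x : ℝ) (G.degree y : ℝ),
      fun x y => by simp [add_comm, min_comm]⟩ e := by
    intro e he
    induction e with
    | _ x y => exact (hedge x y (mem_edgeFinset.1 he)).1
  have hdeg_iff : HSO G = ∑ e ∈ G.edgeFinset, r e ↔ ∀ v, G.degree v ≤ 2 := by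
    rw [eq_comm, HSO, Finset.sum_eq_sum_iff_of_le hle]
    constructor
    · intro h v
      obtain ⟨w, hw⟩ := (G.degree_pos_iff_exists_adj v).1 (hpos v)
      exact ((hedge v w hw).2.1 (h s(v, w) (mem_edgeFinset.2 hw))).1
    · intro h e he
      induction e with
      | _ x y => exact (hedge x y (mem_edgeFinset.1 he)).2.2 ⟨h x, h y⟩
  rw [hsum]
  refine ⟨Finset.sum_le_sum hle, hdeg_iff.trans
    ⟨hconn.nonempty_iso_pathGraph_or_cycleGraph, ?_⟩⟩
  rintro (⟨⟨φ⟩⟩ | ⟨⟨φ⟩⟩) v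
  · classical
    rw [← φ.degree_eq v]
    exact pathGraph_degree_le_two _
  · rw [← φ.degree_eq v]
    exact cycleGraph_degree_le_two _
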